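/- Let 0 < ε < 1 and p(n) = n^{1+ε}. Then (1/N) ∑_{n=1}^N e^{2πi p(n)} → 0 as N → ∞. -/

import Mathlib

open Finset Filter

theorem norm_sum_smul_sub_le {w : ℕ → ℂ} {b : ℕ → ℝ} (hw : ∀ n, ‖w n‖ = 1) (hb : Monotone b)
    (hb0 : 0 ≤ b 0) (N : ℕ) :
    ‖∑ n ∈ range N, b n • (w (n + 1) - w n)‖ ≤ 2 * b N := by
  have key : ‖∑ n ∈ range N, b n • (w (n + 1) - w n) - b N • w N‖ ≤ b N := by
    induction N with
    | zero => simp [hw, abs_of_nonneg hb0]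
    | succ N ih =>
      have hstep : 0 ≤ b (N + 1) - b N := sub_nonneg.2 (hb N.le_succ)
      calc _ = ‖(∑ n ∈ range N, b n • (w (n + 1) - w n) - b N • w N)
              - (b (N + 1) - b N) • w (N + 1)‖ := by
            rw [sum_range_succ]; congr 1; module
        _ ≤ b N + ‖(b (N + 1) - b N) • w (N + 1)‖ := (norm_sub_le _ _).trans (by gcongr)
        _ = b (N + 1) := by rw [norm_smul, hw, Real.norm_of_nonneg hstep]; ring
  have hN : ‖b N • w N‖ = b N := by
    rw [norm_smul, hw, Real.norm_of_nonneg (hb0.trans (hb N.zero_le)), mul_one]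
  linarith [norm_le_norm_sub_add (∑ n ∈ range N, b n • (w (n + 1) - w n)) (b N • w N)]

/-- A discrete form of Fejér's criterion: slowly rotating unit sequences have mean zero. -/
theorem tendsto_mean_zero_of_tendsto_smul_ratio_sub_one {w : ℕ → ℂ} {b : ℕ → ℝ} {κ : ℂ}
    (hw : ∀ n, ‖w n‖ = 1) (hb : Monotone b) (hb0 : 0 ≤ b 0)
    (hbN : Tendsto (fun N : ℕ => b N / N) atTop (nhds 0)) (hκ : κ ≠ 0)
    (h : Tendsto (fun n => b n • (w (n + 1) / w n - 1)) atTop (nhds κ)) :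
    Tendsto (fun N : ℕ => (N : ℝ)⁻¹ • ∑ n ∈ range N, w n) atTop (nhds 0) := by
  have hw0 (n) : w n ≠ 0 := norm_ne_zero_iff.1 (by simp [hw])
  have herr : Tendsto (fun n => w n * (κ - b n • (w (n + 1) / w n - 1))) atTop (nhds 0) := by
    rw [tendsto_zero_iff_norm_tendsto_zero]
    simpa [hw] using (tendsto_const_nhds (x := κ).sub h).norm
  have hmain : Tendsto (fun N : ℕ => (N : ℝ)⁻¹ • ∑ n ∈ range N, b n • (w (n + 1) - w n))
      atTop (nhds 0) := by
    refine squeeze_zero_norm (a := fun N : ℕ => 2 * (b N / N)) (fun N => ?_)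
      (by simpa using hbN.const_mul 2)
    rw [norm_smul, norm_inv, Real.norm_natCast]
    calc _ ≤ (N : ℝ)⁻¹ * (2 * b N) := by gcongr; exact norm_sum_smul_sub_le hw hb hb0 N
      _ = _ := by ring
  have hsum := (herr.cesaro_smul.add hmain).const_mul κ⁻¹
  rw [add_zero, mul_zero] at hsum
  refine hsum.congr fun N => ?_
  rw [← smul_add, ← sum_add_distrib, mul_smul_comm, mul_sum]
  congr 1
  refine sum_congr rfl fun n _ => ?_
  have := hw0 n
  simp only [Complex.real_smul]
  field_simp
  ring

theorem norm_sum_range_shift_sub_le {u : ℕ → ℂ} (hu : ∀ n, ‖u n‖ = 1) (j N : ℕ) :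
    ‖∑ n ∈ range N, u (n + j) - ∑ n ∈ range N, u n‖ ≤ 2 * j := by
  have h1 := sum_range_add u N j
  have h2 := sum_range_add u j N
  have h3 : ∑ n ∈ range N, u (n + j) - ∑ n ∈ range N, u n
      = ∑ n ∈ range j, u (N + n) - ∑ n ∈ range j, u n := by
    rw [add_comm j N] at h2
    simp only [add_comm _ j] at *
    linear_combination h1 - h2
  rw [h3]
  refine (norm_sub_le _ _).trans ?_
  have h4 : ‖∑ n ∈ range j, u (N + n)‖ ≤ j := by
    simpa [hu] using norm_sum_le (range j) (fun n => u (N + n))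
  have h5 : ‖∑ n ∈ range j, u n‖ ≤ j := by simpa [hu] using norm_sum_le (range j) u
  linarith

theorem tendsto_mean_shift_sub_mean {u : ℕ → ℂ} (hu : ∀ n, ‖u n‖ = 1) (j : ℕ) :
    Tendsto (fun N : ℕ => (N : ℝ)⁻¹ • (∑ n ∈ range N, u (n + j) - ∑ n ∈ range N, u n))
      atTop (nhds 0) := by
  refine squeeze_zero_norm (a := fun N : ℕ => (N : ℝ)⁻¹ * (2 * j)) (fun N => ?_)
    (by simpa using (tendsto_inv_atTop_nhds_zero_nat (𝕜 := ℝ)).mul_const (2 * (j : ℝ)))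
  rw [norm_smul, norm_inv, Real.norm_natCast]
  gcongr
  exact norm_sum_range_shift_sub_le hu j N

theorem sq_norm_mean_le (v : ℕ → ℂ) (N : ℕ) :
    ‖(N : ℝ)⁻¹ • ∑ n ∈ range N, v n‖ ^ 2 ≤ (N : ℝ)⁻¹ * ∑ n ∈ range N, ‖v n‖ ^ 2 := by
  rcases N.eq_zero_or_pos with rfl | hN
  · simp
  have hN' : (0 : ℝ) < N := by exact_mod_cast hN
  have h := sq_sum_le_card_mul_sum_sq (s := range N) (f := fun n => ‖v n‖)
  rw [card_range] at h
  rw [norm_smul, norm_inv, Real.norm_natCast, mul_pow]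
  calc _ ≤ (N : ℝ)⁻¹ ^ 2 * (N * ∑ n ∈ range N, ‖v n‖ ^ 2) := by
        gcongr
        exact (pow_le_pow_left₀ (norm_nonneg _) (norm_sum_le _ _) 2).trans h
    _ = _ := by field_simp

/-- The second moment of block sums of length `L`. -/
theorem tendsto_mean_sq_norm_block {u : ℕ → ℂ} (hu : ∀ n, ‖u n‖ = 1)
    (h : ∀ j k, j ≠ k → Tendsto (fun N : ℕ =>
      (N : ℝ)⁻¹ • ∑ n ∈ range N, u (n + j) * starRingEnd ℂ (u (n + k))) atTop (nhds 0)) (L : ℕ) :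
    Tendsto (fun N : ℕ => (N : ℝ)⁻¹ * ∑ n ∈ range N, ‖∑ j ∈ range L, u (n + j)‖ ^ 2)
      atTop (nhds L) := by
  have hlim : Tendsto (fun N : ℕ => ∑ j ∈ range L, ∑ k ∈ range L,
      (N : ℝ)⁻¹ • ∑ n ∈ range N, u (n + j) * starRingEnd ℂ (u (n + k))) atTop
      (nhds (∑ j ∈ range L, ∑ k ∈ range L, if j = k then 1 else 0)) := by
    refine tendsto_finsetSum _ fun j _ => tendsto_finsetSum _ fun k _ => ?_
    split_ifs with hjk
    · subst hjk
      refine tendsto_const_nhds.congr' ?_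
      filter_upwards [eventually_ne_atTop 0] with N hN
      simp [Complex.mul_conj, Complex.normSq_eq_norm_sq, hu, hN]
    · exact h j k hjk
  have hL : ∑ j ∈ range L, ∑ k ∈ range L, (if j = k then (1 : ℂ) else 0) = L := by
    rw [sum_congr rfl fun j hj => by rw [sum_ite_eq, if_pos hj]]
    simp
  rw [hL] at hlim
  refine tendsto_ofReal_iff.1 ?_
  rw [Complex.ofReal_natCast]
  refine hlim.congr fun N => ?_
  simp only [Complex.real_smul, ← mul_sum]
  rw [Complex.ofReal_mul, Complex.ofReal_sum]
  congr 1
  simp only [Complex.ofReal_pow, ← Complex.mul_conj', map_sum, sum_mul_sum]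
  exact (sum_congr rfl fun j _ => sum_comm).trans sum_comm

/-- Van der Corput's difference theorem, for unit sequences. -/
theorem tendsto_mean_zero_of_correlations {u : ℕ → ℂ} (hu : ∀ n, ‖u n‖ = 1)
    (h : ∀ j k, j ≠ k → Tendsto (fun N : ℕ =>
      (N : ℝ)⁻¹ • ∑ n ∈ range N, u (n + j) * starRingEnd ℂ (u (n + k))) atTop (nhds 0)) :
    Tendsto (fun N : ℕ => (N : ℝ)⁻¹ • ∑ n ∈ range N, u n) atTop (nhds 0) := by
  refine Metric.tendsto_nhds.2 fun δ hδ => ?_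
  obtain ⟨L, hL⟩ := exists_nat_gt (4 / δ ^ 2)
  have hL0 : (0 : ℝ) < L := lt_trans (by positivity) hL
  have hblock := tendsto_mean_sq_norm_block hu h L
  have hLδ : (L : ℝ) < (L * (δ / 2)) ^ 2 := by
    rw [div_lt_iff₀ (by positivity)] at hL
    nlinarith
  have hshift : Tendsto (fun N : ℕ => ∑ j ∈ range L,
      (N : ℝ)⁻¹ • (∑ n ∈ range N, u (n + j) - ∑ n ∈ range N, u n)) atTop (nhds 0) := by
    simpa using tendsto_finsetSum (range L) fun j _ => tendsto_mean_shift_sub_mean hu j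
  filter_upwards [hblock.eventually_lt_const hLδ,
    hshift.norm.eventually_lt_const (u := L * (δ / 2)) (by rw [norm_zero]; positivity)]
    with N hN1 hN2
  have hN3 := lt_of_pow_lt_pow_left₀ 2 (by positivity) ((sq_norm_mean_le _ N).trans_lt hN1)
  have heq : (L : ℝ) • ((N : ℝ)⁻¹ • ∑ n ∈ range N, u n)
      = (N : ℝ)⁻¹ • ∑ n ∈ range N, ∑ j ∈ range L, u (n + j) - ∑ j ∈ range L,
        (N : ℝ)⁻¹ • (∑ n ∈ range N, u (n + j) - ∑ n ∈ range N, u n) := by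
    rw [sum_comm, ← smul_sum, sum_sub_distrib, sum_const, card_range, ← Nat.cast_smul_eq_nsmul ℝ]
    module
  have hN4 := norm_sub_le ((N : ℝ)⁻¹ • ∑ n ∈ range N, ∑ j ∈ range L, u (n + j))
    (∑ j ∈ range L, (N : ℝ)⁻¹ • (∑ n ∈ range N, u (n + j) - ∑ n ∈ range N, u n))
  rw [← heq, norm_smul, Real.norm_natCast] at hN4
  rw [dist_zero_right]
  nlinarith

theorem isLittleO_one_add_rpow (p : ℝ) :
    (fun x : ℝ => (1 + x) ^ p - 1 - p * x - p * (p - 1) / 2 * x ^ 2) =o[nhds 0]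
      fun x => x ^ 2 := by
  have hd (q x : ℝ) (hx : -1 < x) :
      HasDerivAt (fun x : ℝ => (1 + x) ^ q) (q * (1 + x) ^ (q - 1)) x := by
    simpa using ((hasDerivAt_id x).const_add 1).rpow_const (p := q) (Or.inl (by simp; linarith))
  have hs : nhdsWithin (0 : ℝ) (Set.Ioi (-1)) = nhds 0 :=
    isOpen_Ioi.nhdsWithin_eq (by simp)
  have h1 : (fun x : ℝ => p * (1 + x) ^ (p - 1) - p - p * (p - 1) * x) =o[nhds 0]
      fun x => x := by
    have := ((hd (p - 1) 0 (by norm_num)).const_mul p).isLittleO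
    simpa [mul_comm, mul_left_comm] using this
  have h2 := (convex_Ioi (-1 : ℝ)).isLittleO_pow_succ_real (x₀ := 0) (n := 1) (by simp)
    (f := fun x : ℝ => (1 + x) ^ p - 1 - p * x - p * (p - 1) / 2 * x ^ 2)
    (f' := fun x : ℝ => p * (1 + x) ^ (p - 1) - p - p * (p - 1) * x)
    (fun x hx => by
      have := (((hd p x hx).sub_const 1).sub ((hasDerivAt_id x).const_mul p)).sub
        (((hasDerivAt_id x).pow 2).const_mul (p * (p - 1) / 2))
      refine (this.congr_deriv ?_).hasDerivWithinAt
      simp; ring)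
    (by simpa [hs] using h1)
  simpa [hs] using h2

theorem tendsto_rpow_second_order (p a : ℝ) :
    Tendsto (fun n : ℕ => (n : ℝ) ^ (2 - p) * ((n + a) ^ p - n ^ p - p * a * n ^ (p - 1)))
      atTop (nhds (p * (p - 1) / 2 * a ^ 2)) := by
  have hx : Tendsto (fun n : ℕ => a / (n : ℝ)) atTop (nhds 0) :=
    tendsto_const_div_atTop_nhds_zero_nat a
  have hO : ((fun x : ℝ => x ^ 2) ∘ fun n : ℕ => a / (n : ℝ)) =O[atTop]
      fun n : ℕ => ((n : ℝ)⁻¹) ^ 2 :=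
    Asymptotics.IsBigO.of_bound (a ^ 2) (by simp [div_eq_mul_inv, mul_pow])
  have h := ((isLittleO_one_add_rpow p).comp_tendsto hx).trans_isBigO hO
  have h' := h.tendsto_div_nhds_zero.add_const (p * (p - 1) / 2 * a ^ 2)
  rw [zero_add] at h'
  refine h'.congr' ?_
  filter_upwards [eventually_gt_atTop 0,
    hx.eventually_const_lt (show (-1 : ℝ) < 0 by norm_num)] with n hn hna
  have hn' : (0 : ℝ) < n := by exact_mod_cast hn
  have e1 : ((n : ℝ) + a) ^ p = n ^ p * (1 + a / n) ^ p := by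
    rw [← Real.mul_rpow hn'.le (by linarith)]
    congr 1
    field_simp
  have e2 : (n : ℝ) ^ (2 - p) = n ^ 2 / n ^ p := by
    rw [Real.rpow_sub hn']; norm_num
  have e3 : (n : ℝ) ^ (p - 1) = n ^ p / n := Real.rpow_sub_one hn'.ne' p
  have e4 : (n : ℝ) ^ p ≠ 0 := (Real.rpow_pos_of_pos hn' p).ne'
  rw [e1, e2, e3]
  simp only [Function.comp_apply]
  field_simp
  ring

theorem tendsto_smul_exp_sub_one {b : ℕ → ℝ} {z : ℕ → ℂ} {κ : ℂ} (hb : Tendsto b atTop atTop)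
    (h : Tendsto (fun n => b n • z n) atTop (nhds κ)) :
    Tendsto (fun n => b n • (Complex.exp (z n) - 1)) atTop (nhds κ) := by
  have hz : Tendsto z atTop (nhds 0) := by
    have := (tendsto_inv_atTop_zero.comp hb).smul h
    rw [zero_smul] at this
    refine this.congr' ?_
    filter_upwards [hb.eventually_ne_atTop 0] with n hn
    simp [hn]
  have hslope : Tendsto (fun n => dslope Complex.exp 0 (z n)) atTop (nhds 1) := by
    have := (continuousAt_dslope_same.2 (Complex.differentiableAt_exp (x := 0))).tendsto.comp hz
    simpa [dslope_same, Function.comp_def] using this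
  have := h.mul hslope
  rw [mul_one] at this
  refine this.congr fun n => ?_
  have hexp := sub_smul_dslope Complex.exp 0 (z n)
  rw [sub_zero, smul_eq_mul, Complex.exp_zero] at hexp
  rw [smul_mul_assoc, hexp]

/-- The discrete second differences `f (n + j + 2) - f (n + k + 2) - f (n + j + 1) + f (n + k + 1)`
of `f x = x ^ p` are asymptotic to `(j - k) * f'' n`. -/
theorem tendsto_rpow_second_difference (p : ℝ) (j k : ℕ) :
    Tendsto (fun n : ℕ => (n : ℝ) ^ (2 - p) * (((n + (j + 2)) ^ p - (n + (k + 2)) ^ p)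
      - ((n + (j + 1)) ^ p - (n + (k + 1)) ^ p) : ℝ)) atTop (nhds (p * (p - 1) * (j - k))) := by
  have h := ((tendsto_rpow_second_order p (j + 2)).sub (tendsto_rpow_second_order p (k + 2))).sub
    ((tendsto_rpow_second_order p (j + 1)).sub (tendsto_rpow_second_order p (k + 1)))
  convert h using 2 <;> ring

theorem tendsto_rpow_correlation {p : ℝ} (hp1 : 1 < p) (hp2 : p < 2) {j k : ℕ} (hjk : j ≠ k) :
    Tendsto (fun N : ℕ => (N : ℝ)⁻¹ • ∑ n ∈ range N,
      Complex.exp ((2 * Real.pi * ((n : ℝ) + (j + 1)) ^ p : ℝ) * Complex.I) *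
      starRingEnd ℂ (Complex.exp ((2 * Real.pi * ((n : ℝ) + (k + 1)) ^ p : ℝ) * Complex.I)))
      atTop (nhds 0) := by
  have hb : Tendsto (fun n : ℕ => (n : ℝ) ^ (2 - p)) atTop atTop :=
    (tendsto_rpow_atTop (by linarith)).comp tendsto_natCast_atTop_atTop
  have hdiff : ((j : ℝ) - k) ≠ 0 := sub_ne_zero.2 (by exact_mod_cast hjk)
  refine tendsto_mean_zero_of_tendsto_smul_ratio_sub_one (b := fun n : ℕ => (n : ℝ) ^ (2 - p))
    (κ := ((2 * Real.pi * (p * (p - 1) * (j - k)) : ℝ) : ℂ) * Complex.I) ?_ ?_ ?_ ?_ ?_ ?_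
  · intro n
    rw [norm_mul, RCLike.norm_conj, Complex.norm_exp_ofReal_mul_I, Complex.norm_exp_ofReal_mul_I,
      mul_one]
  · exact fun m n hmn => Real.rpow_le_rpow m.cast_nonneg (by exact_mod_cast hmn) (by linarith)
  · positivity
  · refine ((tendsto_rpow_neg_atTop (show 0 < p - 1 by linarith)).comp
      tendsto_natCast_atTop_atTop).congr' ?_
    filter_upwards [eventually_ne_atTop 0] with n hn
    rw [Function.comp_apply, ← Real.rpow_sub_one (by exact_mod_cast hn)]
    ring_nf
  · have : (2 * Real.pi * (p * (p - 1) * (j - k)) : ℝ) ≠ 0 := by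
      have : p - 1 ≠ 0 := by linarith
      have : p ≠ 0 := by linarith
      have := Real.pi_ne_zero
      positivity
    exact mul_ne_zero (Complex.ofReal_ne_zero.2 this) Complex.I_ne_zero
  · have h := ((Complex.continuous_ofReal.tendsto _).comp
      ((tendsto_rpow_second_difference p j k).const_mul (2 * Real.pi))).mul_const Complex.I
    refine (tendsto_smul_exp_sub_one hb (z := fun n : ℕ => ((2 * Real.pi *
      (((n + (j + 2)) ^ p - (n + (k + 2)) ^ p) - ((n + (j + 1)) ^ p - (n + (k + 1)) ^ p)) : ℝ) : ℂ)
      * Complex.I) (h.congr fun n => ?_)).congr fun n => ?_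
    · rw [Complex.real_smul, ← mul_assoc, ← Complex.ofReal_mul, Function.comp_apply]
      congr 2
      ring
    · simp only [← Complex.exp_conj, map_mul, Complex.conj_ofReal, Complex.conj_I,
        ← Complex.exp_add, ← Complex.exp_sub]
      congr 3
      push_cast
      rw [show (n : ℝ) + 1 + (j + 1) = n + (j + 2) by ring,
        show (n : ℝ) + 1 + (k + 1) = n + (k + 2) by ring]
      ring

theorem exp_sum_rpow_tendsto_zero (ε : ℝ) (hε0 : 0 < ε) (hε1 : ε < 1) :
    Tendsto (fun N : ℕ =>
        (1 / (N : ℂ)) * ∑ n ∈ Icc 1 N, Complex.exp (2 * Real.pi * Complex.I * ((n : ℝ) ^ (1 + ε) : ℝ)))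
      atTop (nhds 0) := by
  have h := tendsto_mean_zero_of_correlations
    (u := fun n : ℕ =>
      Complex.exp ((2 * Real.pi * ((n : ℝ) + 1) ^ (1 + ε) : ℝ) * Complex.I))
    (fun n => Complex.norm_exp_ofReal_mul_I _) (fun j k hjk => by
      simpa only [Nat.cast_add, add_assoc] using
        tendsto_rpow_correlation (p := 1 + ε) (by linarith) (by linarith) hjk)
  refine h.congr fun N => ?_
  rw [Complex.real_smul, Complex.ofReal_inv, Complex.ofReal_natCast, one_div, range_eq_Ico,
    ← Ico_add_one_right_eq_Icc, ← sum_Ico_add' _ 0 N 1]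
  congr 1
  refine sum_congr rfl fun n _ => ?_
  push_cast
  congr 1
  ring
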